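/- arXiv:2405.06292 — 2 statements merged into one kernel-verified Lean document; each statement's English description precedes it below -/
import Mathlib

section
/- Let C_1,…,C_s ⊆ F_q^n be linear codes and A a non-singular s×s matrix over F_q. Then the Euclidean dual of the matrix-product code C(A) = [C_1,…,C_s]·A satisfies C(A)^{⊥E} = [C_1^{⊥E}, C_2^{⊥E}, …, C_s^{⊥E}]·(A^{-1})^T. -/
open Matrix Finset Kronecker

variable {F : Type} [Field F] [DecidableEq F]

/-- Entrywise application of the map `π_e : x ↦ x ^ (p ^ e)` to a matrix. -/
def piE (p e : ℕ) {m n : Type} (A : Matrix m n F) : Matrix m n F :=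
  A.map fun x => x ^ p ^ e

/-- Entrywise application of `π_e` to a vector. -/
def piEv (p e : ℕ) {n : Type} (v : n → F) : n → F := fun i => v i ^ p ^ e

/-- A monomial matrix: exactly one nonzero entry in each row and each column. -/
def IsMonomial {n : Type} [Fintype n] (M : Matrix n n F) : Prop :=
  (∀ i, ∃! j, M i j ≠ 0) ∧ (∀ j, ∃! i, M i j ≠ 0)

/-- Non-singular by columns (NSC): for each `ℓ`, every `ℓ × ℓ` submatrix formed by the first
`ℓ` rows and any `ℓ` columns (in increasing order) is non-singular. -/
def IsNSC {s : ℕ} (A : Matrix (Fin s) (Fin s) F) : Prop :=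
  ∀ (ℓ : ℕ) (hℓ : ℓ ≤ s) (j : Fin ℓ → Fin s), StrictMono j →
    (Matrix.of fun a b : Fin ℓ => A (Fin.castLE hℓ a) (j b)).det ≠ 0

/-- Toeplitz matrix: constant along diagonals. -/
def IsToeplitz {s : ℕ} (A : Matrix (Fin s) (Fin s) F) : Prop :=
  ∀ (i j : ℕ) (hi : i + 1 < s) (hj : j + 1 < s),
    A ⟨i, Nat.lt_of_succ_lt hi⟩ ⟨j, Nat.lt_of_succ_lt hj⟩ = A ⟨i + 1, hi⟩ ⟨j + 1, hj⟩

/-- The anti-diagonal matrix `Q` with ones on the anti-diagonal. -/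
def antiDiagQ (F : Type) [Field F] (s : ℕ) : Matrix (Fin s) (Fin s) F :=
  Matrix.of fun i j => if (i : ℕ) + (j : ℕ) + 1 = s then 1 else 0

/-- Dual of a code with respect to the pairing `⟨u, c⟩ = ∑ j, u j * g c j`. -/
def dualWith {n : Type} [Fintype n] (g : (n → F) → n → F) (C : Submodule F (n → F)) :
    Submodule F (n → F) where
  carrier := {u | ∀ c ∈ C, ∑ j, u j * g c j = 0}
  add_mem' := by
    intro a b ha hb c hc
    simp only [Pi.add_apply, add_mul, Finset.sum_add_distrib, ha c hc, hb c hc, add_zero]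
  zero_mem' := by
    intro c hc
    simp
  smul_mem' := by
    intro r a ha c hc
    simp only [Pi.smul_apply, smul_eq_mul, mul_assoc, ← Finset.mul_sum, ha c hc, mul_zero]

/-- The `σ = (M, e)` dual of a linear code. -/
def sigmaDual {n : Type} [Fintype n] (p e : ℕ) (M : Matrix n n F)
    (C : Submodule F (n → F)) : Submodule F (n → F) :=
  dualWith (fun c => Matrix.vecMul (piEv p e c) M) C

/-- The Euclidean dual of a linear code. -/
def euclidDual {n : Type} [Fintype n] (C : Submodule F (n → F)) : Submodule F (n → F) :=
  dualWith id C

/-- The matrix-product code `[C_1, …, C_s] · A`, realized inside `Fin s × Fin n → F`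
(block `j` of a codeword is `∑ i, A i j • c i`). -/
def matrixProductCode {n s : ℕ} (C : Fin s → Submodule F (Fin n → F))
    (A : Matrix (Fin s) (Fin s) F) : Submodule F (Fin s × Fin n → F) where
  carrier := {x | ∃ c : Fin s → Fin n → F, (∀ i, c i ∈ C i) ∧
    ∀ jt : Fin s × Fin n, x jt = ∑ i, A i jt.1 * c i jt.2}
  add_mem' := by
    rintro x y ⟨c, hc, hx⟩ ⟨d, hd, hy⟩
    refine ⟨c + d, fun i => (C i).add_mem (hc i) (hd i), fun jt => ?_⟩
    simp [hx jt, hy jt, mul_add, Finset.sum_add_distrib]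
  zero_mem' := ⟨0, fun i => (C i).zero_mem, fun jt => by simp⟩
  smul_mem' := by
    rintro r x ⟨c, hc, hx⟩
    refine ⟨r • c, fun i => (C i).smul_mem r (hc i), fun jt => ?_⟩
    simp [hx jt, Finset.mul_sum, mul_left_comm]

/-- The minimum distance of the code `C` is at least `d`. -/
def minDistGe {n : Type} [Fintype n] (C : Submodule F (n → F)) (d : ℕ) : Prop :=
  ∀ x ∈ C, x ≠ 0 → d ≤ hammingNorm x

/-- The code `C` has minimum distance exactly `d`. -/
def minDistEq {n : Type} [Fintype n] (C : Submodule F (n → F)) (d : ℕ) : Prop :=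
  minDistGe C d ∧ ∃ x ∈ C, x ≠ 0 ∧ hammingNorm x = d

theorem mem_euclidDual {F : Type} [Field F] {n : Type} [Fintype n] {C : Submodule F (n → F)} {u : n → F} :
    u ∈ euclidDual C ↔ ∀ c ∈ C, ∑ j, u j * c j = 0 :=
  Iff.rfl

theorem mem_matrixProductCode {F : Type} [Field F] {n s : ℕ} {C : Fin s → Submodule F (Fin n → F)}
    {A : Matrix (Fin s) (Fin s) F} {x : Fin s × Fin n → F} :
    x ∈ matrixProductCode C A ↔ ∃ c : Fin s → Fin n → F, (∀ i, c i ∈ C i) ∧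
      ∀ jt : Fin s × Fin n, x jt = ∑ i, A i jt.1 * c i jt.2 :=
  Iff.rfl

/-- Moving the defining matrix to the other side of the Euclidean pairing. -/
theorem sum_mul_sum_mul_eq {F : Type} [Field F] {n s : ℕ} (A : Matrix (Fin s) (Fin s) F)
    (x : Fin s × Fin n → F) (c : Fin s → Fin n → F) :
    ∑ jt : Fin s × Fin n, x jt * ∑ i, A i jt.1 * c i jt.2 =
      ∑ i, ∑ t, (∑ j, A i j * x (j, t)) * c i t := by
  simp only [Fintype.sum_prod_type, Finset.mul_sum, Finset.sum_mul]
  rw [Finset.sum_comm, Finset.sum_comm (s := (univ : Finset (Fin s))) (t := univ)]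
  refine Finset.sum_congr rfl fun t _ => ?_
  rw [Finset.sum_comm]
  exact Finset.sum_congr rfl fun i _ => Finset.sum_congr rfl fun j _ => by ring

theorem mem_euclidDual_matrixProductCode {F : Type} [Field F] {n s : ℕ} {C : Fin s → Submodule F (Fin n → F)}
    {A : Matrix (Fin s) (Fin s) F} {x : Fin s × Fin n → F} :
    x ∈ euclidDual (matrixProductCode C A) ↔
      ∀ i, (fun t => ∑ j, A i j * x (j, t)) ∈ euclidDual (C i) := by
  simp only [mem_euclidDual]
  constructor
  · intro hx i c hc
    have hmem : ∀ k, (Pi.single i c : Fin s → Fin n → F) k ∈ C k := by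
      intro k
      obtain rfl | hk := eq_or_ne k i
      · simpa using hc
      · simp [hk]
    have h := hx _ (mem_matrixProductCode.2 ⟨Pi.single i c, hmem, fun _ => rfl⟩)
    rw [sum_mul_sum_mul_eq, Finset.sum_eq_single i (fun k _ hk => by simp [hk])
      (by simp)] at h
    simpa using h
  · intro hx y hy
    obtain ⟨c, hc, hyc⟩ := mem_matrixProductCode.1 hy
    simp only [hyc]
    rw [sum_mul_sum_mul_eq]
    exact Finset.sum_eq_zero fun i _ => hx i (c i) (hc i)

theorem mem_matrixProductCode_inv_transpose {F : Type} [Field F] {n s : ℕ} {C : Fin s → Submodule F (Fin n → F)}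
    {A : Matrix (Fin s) (Fin s) F} (hA : IsUnit A.det) {x : Fin s × Fin n → F} :
    x ∈ matrixProductCode C (A⁻¹)ᵀ ↔ ∀ i, (fun t => ∑ j, A i j * x (j, t)) ∈ C i := by
  rw [mem_matrixProductCode]
  constructor
  · rintro ⟨c, hc, hx⟩ i
    convert hc i using 1
    have h : A * (A⁻¹ * Matrix.of c) = Matrix.of c := Matrix.mul_nonsing_inv_cancel_left A _ hA
    ext t
    simpa [Matrix.mul_apply, hx] using congrFun (congrFun h i) t
  · intro hx
    refine ⟨_, hx, fun ⟨j, t⟩ => ?_⟩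
    have h := Matrix.nonsing_inv_mul_cancel_left A (Matrix.of fun j t => x (j, t)) hA
    simpa [Matrix.mul_apply] using (congrFun (congrFun h j) t).symm

/-- the Euclidean dual of a matrix-product code with non-singular defining
matrix `A` is `[C_1^{⊥E}, …, C_s^{⊥E}] · (A⁻¹)ᵀ`. -/
theorem stmt16 {F : Type} [Field F] [Fintype F] [DecidableEq F]
    {n s : ℕ} (C : Fin s → Submodule F (Fin n → F))
    (A : Matrix (Fin s) (Fin s) F) (hAdet : IsUnit A.det) :
    euclidDual (matrixProductCode C A) =
      matrixProductCode (fun i => euclidDual (C i)) (A⁻¹)ᵀ := by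
  ext x
  rw [mem_euclidDual_matrixProductCode, mem_matrixProductCode_inv_transpose hAdet]
end

section
/- Let C_i be an [n,k_i,d_i]_q linear code with 0 < k_i < n and Euclidean dual distance d_i^{⊥E} for i = 1,…,s, and let A be an s×s non-singular by columns (NSC) matrix over F_q. Then the matrix-product code C(A) = [C_1,…,C_s]·A has length sn, dimension Σ_{i=1}^s k_i, and minimum distance at least min{(s+1−i)·d_i : 1 ≤ i ≤ s}, and its Euclidean dual C(A)^{⊥E} has length sn, dimension sn − Σ_{i=1}^s k_i, and minimum distance at least min{i·d_i^{⊥E} : 1 ≤ i ≤ s}. -/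
open Matrix Finset Kronecker

variable {F : Type} [Field F] [DecidableEq F]

section Helpers

variable {K : Type} [Field K]

/-- A column combination of an NSC matrix that is annihilated by the first `r` rows but not by
row `r` involves more than `r` columns. -/
lemma IsNSC.lt_card_support [DecidableEq K] {s : ℕ} {A : Matrix (Fin s) (Fin s) K}
    (hA : IsNSC A) {y : Fin s → K} {r : Fin s} (hr : (A *ᵥ y) r ≠ 0) (h0 : ∀ i < r, (A *ᵥ y) i = 0) :
    (r : ℕ) + 1 ≤ #{j | y j ≠ 0} := by
  by_contra! hlt
  obtain ⟨T, hsub, -, hT⟩ := Finset.exists_subsuperset_card_eq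
    (s := ({j | y j ≠ 0} : Finset (Fin s))) (Finset.subset_univ _)
    (Nat.lt_succ_iff.mp hlt) (by simp)
  have hsum (f : Fin s → K) : ∑ b, f (T.orderEmbOfFin hT b) * y (T.orderEmbOfFin hT b)
      = ∑ j, f j * y j := by
    rw [← Finset.sum_subset (Finset.subset_univ T)
      (fun j _ hj => by
        have : y j = 0 := by
          by_contra h
          exact hj (hsub (by simpa using h))
        simp [this])]
    conv_rhs => rw [← Finset.map_orderEmbOfFin_univ T hT, Finset.sum_map]
    rfl
  have hy : (fun b => y (T.orderEmbOfFin hT b)) = 0 := by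
    refine Matrix.eq_zero_of_mulVec_eq_zero
      (hA r r.is_lt.le _ (T.orderEmbOfFin hT).strictMono) ?_
    funext a
    have ha := h0 (Fin.castLE r.is_lt.le a) (by simp [Fin.lt_def])
    exact (hsum _).trans ha
  apply hr
  calc (A *ᵥ y) r = _ := (hsum (A r)).symm
    _ = 0 := Finset.sum_eq_zero fun b _ => by simp [congrFun hy b]

/-- A row combination of an NSC matrix whose last nonzero coefficient is at row `r` vanishes in
at most `r` columns. -/
lemma IsNSC.sub_le_card_support [DecidableEq K] {s : ℕ} {A : Matrix (Fin s) (Fin s) K}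
    (hA : IsNSC A) {v : Fin s → K} {r : Fin s} (hr : v r ≠ 0) (h0 : ∀ i, r < i → v i = 0) :
    s - (r : ℕ) ≤ #{j | (v ᵥ* A) j ≠ 0} := by
  by_contra! hlt
  have hcard := Finset.card_filter_add_card_filter_not (s := (Finset.univ : Finset (Fin s)))
    (fun j => (v ᵥ* A) j = 0)
  rw [Finset.card_univ, Fintype.card_fin] at hcard
  obtain ⟨T, hsub, hT⟩ := Finset.exists_subset_card_eq
    (s := ({j | (v ᵥ* A) j = 0} : Finset (Fin s))) (n := (r : ℕ) + 1)
    (by simp only [ne_eq] at hlt; omega)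
  have hv : (fun a : Fin ((r : ℕ) + 1) => v (Fin.castLE r.is_lt a)) = 0 := by
    refine Matrix.eq_zero_of_vecMul_eq_zero
      (hA (r + 1) r.is_lt _ (T.orderEmbOfFin hT).strictMono) ?_
    funext b
    have hb := hsub (T.orderEmbOfFin_mem hT b)
    rw [Finset.mem_filter] at hb
    refine Eq.trans ?_ hb.2
    change ∑ a, v (Fin.castLE r.is_lt a) * A (Fin.castLE r.is_lt a) _ = ∑ i, v i * A i _
    rw [← Finset.sum_subset (Finset.subset_univ (Finset.univ.map (Fin.castLEEmb r.is_lt)))]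
    · simp
    · intro i _ hi
      rw [h0 i, zero_mul]
      by_contra! hir
      exact hi (Finset.mem_map.mpr
        ⟨⟨i, Nat.lt_succ_of_le hir⟩, Finset.mem_univ _, rfl⟩)
  exact hr (congrFun hv (Fin.last r))

lemma IsNSC.det_ne_zero {s : ℕ} {A : Matrix (Fin s) (Fin s) K} (hA : IsNSC A) : A.det ≠ 0 :=
  hA s le_rfl id strictMono_id

lemma mul_hammingNorm_le_hammingNorm [DecidableEq K] {ι κ : Type} [Fintype ι] [Fintype κ] {m : ℕ}
    {c : κ → K} {x : ι × κ → K} (h : ∀ t, c t ≠ 0 → m ≤ #{j | x (j, t) ≠ 0}) :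
    m * hammingNorm c ≤ hammingNorm x := by
  have hx : hammingNorm x = ∑ t, #{j | x (j, t) ≠ 0} := by
    simp only [hammingNorm, Finset.card_filter]
    exact Fintype.sum_prod_type_right _
  rw [hx, mul_comm, ← smul_eq_mul]
  refine (Finset.card_nsmul_le_sum _ _ m fun t ht => ?_).trans
    (Finset.sum_le_sum_of_subset (Finset.subset_univ _))
  exact h t (Finset.mem_filter.mp ht).2

lemma finrank_euclidDual {ι : Type} [Fintype ι] (C : Submodule K (ι → K)) :
    Module.finrank K (euclidDual C) = Fintype.card ι - Module.finrank K C := by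
  classical
  have hC : euclidDual C =
      (C.dualAnnihilator).comap (dotProductEquiv K ι).toLinearMap := by
    ext u
    simp [euclidDual, dualWith, Submodule.mem_dualAnnihilator, dotProduct]
  have h := Subspace.finrank_add_finrank_dualAnnihilator_eq C
  rw [hC, Submodule.comap_equiv_eq_map_symm, LinearEquiv.finrank_map_eq]
  rw [Module.finrank_fintype_fun_eq_card] at h
  omega

lemma finrank_matrixProductCode {n s : ℕ} (C : Fin s → Submodule K (Fin n → K))
    {A : Matrix (Fin s) (Fin s) K} (hA : A.det ≠ 0) :
    Module.finrank K (matrixProductCode C A) = ∑ i, Module.finrank K (C i) := by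
  let φ : ((i : Fin s) → C i) →ₗ[K] (Fin s × Fin n → K) :=
    { toFun := fun c jt => ∑ i, A i jt.1 * (c i : Fin n → K) jt.2
      map_add' := fun c c' => by ext; simp [mul_add, Finset.sum_add_distrib]
      map_smul' := fun a c => by ext; simp [Finset.mul_sum, mul_left_comm] }
  have hφ : LinearMap.range φ = matrixProductCode C A := by
    ext x
    constructor
    · rintro ⟨c, rfl⟩
      exact ⟨fun i => c i, fun i => (c i).2, fun _ => rfl⟩
    · rintro ⟨c, hc, hx⟩
      exact ⟨fun i => ⟨c i, hc i⟩, funext fun jt => (hx jt).symm⟩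
  have hinj : Function.Injective φ := by
    rw [← LinearMap.ker_eq_bot, LinearMap.ker_eq_bot']
    intro c hc
    ext i t
    have h : (fun i => (c i : Fin n → K) t) ᵥ* A = 0 := by
      funext j
      simpa [φ, Matrix.vecMul, dotProduct, mul_comm] using congrFun hc (j, t)
    exact congrFun (Matrix.eq_zero_of_vecMul_eq_zero hA h) i
  rw [← hφ, LinearMap.finrank_range_of_inj hinj, Module.finrank_pi_fintype]

lemma IsNSC.exists_mul_le_hammingNorm [DecidableEq K] {n s : ℕ} {C : Fin s → Submodule K (Fin n → K)}
    {d : Fin s → ℕ} (hd : ∀ i, minDistGe (C i) (d i)) {A : Matrix (Fin s) (Fin s) K}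
    (hA : IsNSC A) {x : Fin s × Fin n → K} (hx : x ∈ matrixProductCode C A) (hx0 : x ≠ 0) :
    ∃ i : Fin s, (s - (i : ℕ)) * d i ≤ hammingNorm x := by
  obtain ⟨c, hc, hxc⟩ := hx
  have hne : ({i | c i ≠ 0} : Finset (Fin s)).Nonempty := by
    by_contra! h
    refine hx0 (funext fun jt => (hxc jt).trans (Finset.sum_eq_zero fun i _ => ?_))
    have hi : c i = 0 := by simpa using Finset.filter_eq_empty_iff.mp h (Finset.mem_univ i)
    simp [hi]
  obtain ⟨r, hr, hmax⟩ := Finset.exists_max_image _ id hne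
  rw [Finset.mem_filter] at hr
  have hzero (i : Fin s) (hi : r < i) : c i = 0 := by
    by_contra h
    exact (hmax i (by simpa using h)).not_gt hi
  refine ⟨r, (Nat.mul_le_mul_left _ (hd r (c r) (hc r) hr.2)).trans
    (mul_hammingNorm_le_hammingNorm fun t ht => ?_)⟩
  refine (hA.sub_le_card_support (v := fun i => c i t) ht
    fun i hi => by simp [hzero i hi]).trans_eq ?_
  simp [hxc, Matrix.vecMul, dotProduct, mul_comm]

lemma mulVec_mem_euclidDual {n s : ℕ} {C : Fin s → Submodule K (Fin n → K)}
    {A : Matrix (Fin s) (Fin s) K} {y : Fin s × Fin n → K}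
    (hy : y ∈ euclidDual (matrixProductCode C A)) (i : Fin s) :
    (fun t => (A *ᵥ fun j => y (j, t)) i) ∈ euclidDual (C i) := by
  intro c hc
  have h := hy (fun jt => A i jt.1 * c jt.2)
    ⟨Pi.single i c, fun i' => by
      obtain rfl | h := eq_or_ne i' i
      · simpa using hc
      · simp [h], fun jt => by
      rw [Finset.sum_eq_single i] <;> simp +contextual⟩
  rw [Fintype.sum_prod_type_right] at h
  rw [← h]
  refine Finset.sum_congr rfl fun t _ => ?_
  simp only [Matrix.mulVec, dotProduct, Finset.sum_mul, id]
  exact Finset.sum_congr rfl fun j _ => by ring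

lemma IsNSC.exists_mul_le_hammingNorm_euclidDual [DecidableEq K] {n s : ℕ}
    {C : Fin s → Submodule K (Fin n → K)} {d : Fin s → ℕ}
    (hd : ∀ i, minDistGe (euclidDual (C i)) (d i)) {A : Matrix (Fin s) (Fin s) K}
    (hA : IsNSC A) {y : Fin s × Fin n → K} (hy : y ∈ euclidDual (matrixProductCode C A))
    (hy0 : y ≠ 0) : ∃ i : Fin s, ((i : ℕ) + 1) * d i ≤ hammingNorm y := by
  let u : Fin s → Fin n → K := fun i t => (A *ᵥ fun j => y (j, t)) i
  have hne : ({i | u i ≠ 0} : Finset (Fin s)).Nonempty := by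
    by_contra! h
    refine hy0 (funext fun jt => ?_)
    have hu : (A *ᵥ fun j => y (j, jt.2)) = 0 := funext fun i => by
      have hi : u i = 0 := by simpa using Finset.filter_eq_empty_iff.mp h (Finset.mem_univ i)
      exact congrFun hi jt.2
    exact congrFun (Matrix.eq_zero_of_mulVec_eq_zero hA.det_ne_zero hu) jt.1
  obtain ⟨r, hr, hmin⟩ := Finset.exists_min_image _ id hne
  rw [Finset.mem_filter] at hr
  have hzero (i : Fin s) (hi : i < r) : u i = 0 := by
    by_contra h
    exact (hmin i (by simpa using h)).not_gt hi
  exact ⟨r, (Nat.mul_le_mul_left _ (hd r (u r) (mulVec_mem_euclidDual hy r) hr.2)).trans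
    (mul_hammingNorm_le_hammingNorm fun t ht =>
      hA.lt_card_support ht fun i hi => congrFun (hzero i hi) t)⟩

end Helpers

/-- parameters of a matrix-product code with NSC defining matrix and of its
Euclidean dual. -/
theorem stmt18 {F : Type} [Field F] [Fintype F] [DecidableEq F]
    {n s : ℕ} (hs : 0 < s)
    (C : Fin s → Submodule F (Fin n → F)) (k d dE : Fin s → ℕ)
    (hk : ∀ i, Module.finrank F (C i) = k i)
    (hk0 : ∀ i, 0 < k i) (hkn : ∀ i, k i < n)
    (hd : ∀ i, minDistEq (C i) (d i))
    (hdE : ∀ i, minDistEq (euclidDual (C i)) (dE i))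
    (A : Matrix (Fin s) (Fin s) F) (hA : IsNSC A) :
    Module.finrank F (matrixProductCode C A) = ∑ i, k i ∧
    minDistGe (matrixProductCode C A)
      (Finset.univ.inf' (Finset.univ_nonempty_iff.mpr ⟨⟨0, hs⟩⟩)
        fun i : Fin s => (s - (i : ℕ)) * d i) ∧
    Module.finrank F (euclidDual (matrixProductCode C A)) = s * n - ∑ i, k i ∧
    minDistGe (euclidDual (matrixProductCode C A))
      (Finset.univ.inf' (Finset.univ_nonempty_iff.mpr ⟨⟨0, hs⟩⟩)
        fun i : Fin s => ((i : ℕ) + 1) * dE i) := by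
  refine ⟨?_, ?_, ?_, ?_⟩
  · simp only [finrank_matrixProductCode C hA.det_ne_zero, hk]
  · intro x hx hx0
    obtain ⟨i, hi⟩ := hA.exists_mul_le_hammingNorm (fun i => (hd i).1) hx hx0
    exact (Finset.inf'_le _ (Finset.mem_univ i)).trans hi
  · simp [finrank_euclidDual, finrank_matrixProductCode C hA.det_ne_zero, hk]
  · intro y hy hy0
    obtain ⟨i, hi⟩ := hA.exists_mul_le_hammingNorm_euclidDual (fun i => (hdE i).1) hy hy0
    exact (Finset.inf'_le _ (Finset.mem_univ i)).trans hi
end
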